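/- Let h be a continuous function on a compact interval [a,b] and T(h) its least concave majorant. Then the set {t ∈ [a,b] : T(h)(t) > h(t)} is open in [a,b], and T(h) is affine (linear) on each connected component (open interval) of this set. -/

import Mathlib

open Set

/-- Least concave majorant of `h` on `[a,b]`. -/
noncomputable def lcm (a b : ℝ) (h : ℝ → ℝ) (t : ℝ) : ℝ :=
  sInf {y : ℝ | ∃ z : ℝ → ℝ, ConcaveOn ℝ (Icc a b) z ∧ (∀ x ∈ Icc a b, h x ≤ z x) ∧ y = z t}

lemma aux_bdd (a b : ℝ) (h : ℝ → ℝ) (t : ℝ) (ht : t ∈ Icc a b) :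
    BddBelow {y : ℝ | ∃ z : ℝ → ℝ, ConcaveOn ℝ (Icc a b) z ∧
      (∀ x ∈ Icc a b, h x ≤ z x) ∧ y = z t} :=
  ⟨h t, by rintro y ⟨z, _, hz, rfl⟩; exact hz t ht⟩

lemma aux_nonempty (a b : ℝ) (h : ℝ → ℝ) (hcont : ContinuousOn h (Icc a b)) (t : ℝ) :
    {y : ℝ | ∃ z : ℝ → ℝ, ConcaveOn ℝ (Icc a b) z ∧
      (∀ x ∈ Icc a b, h x ≤ z x) ∧ y = z t}.Nonempty := by
  obtain ⟨M, hM⟩ := isCompact_Icc.bddAbove_image hcont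
  exact ⟨M, fun _ => M, concaveOn_const M (convex_Icc a b),
    fun x hx => hM (mem_image_of_mem h hx), rfl⟩

lemma aux_le (a b : ℝ) (h z : ℝ → ℝ) (hz : ConcaveOn ℝ (Icc a b) z)
    (hm : ∀ x ∈ Icc a b, h x ≤ z x) (t : ℝ) (ht : t ∈ Icc a b) : lcm a b h t ≤ z t :=
  csInf_le (aux_bdd a b h t ht) ⟨z, hz, hm, rfl⟩

lemma aux_ge (a b : ℝ) (h : ℝ → ℝ) (hcont : ContinuousOn h (Icc a b)) (t : ℝ)
    (ht : t ∈ Icc a b) : h t ≤ lcm a b h t :=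
  le_csInf (aux_nonempty a b h hcont t) (by rintro y ⟨z, _, hz, rfl⟩; exact hz t ht)

lemma aux_concave (a b : ℝ) (h : ℝ → ℝ) (hcont : ContinuousOn h (Icc a b)) :
    ConcaveOn ℝ (Icc a b) (lcm a b h) := by
  refine ⟨convex_Icc a b, ?_⟩
  intro x hx y hy c d hc hd hcd
  refine le_csInf (aux_nonempty a b h hcont _) ?_
  rintro w ⟨z, hz, hm, rfl⟩
  refine le_trans ?_ (hz.2 hx hy hc hd hcd)
  simp only [smul_eq_mul]
  gcongr
  · exact aux_le a b h z hz hm x hx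
  · exact aux_le a b h z hz hm y hy

lemma aux_end (a b : ℝ) (h : ℝ → ℝ) (hcont : ContinuousOn h (Icc a b)) (e : ℝ)
    (he : e ∈ Icc a b)
    (hext : ∀ x ∈ Icc a b, ∀ y ∈ Icc a b, ∀ c d : ℝ, 0 < c → 0 < d → c + d = 1 →
      c * x + d * y = e → x = e ∧ y = e) : lcm a b h e ≤ h e := by
  have hL := aux_concave a b h hcont
  have hge := aux_ge a b h hcont
  have hzL : ∀ x ∈ Icc a b, Function.update (lcm a b h) e (h e) x ≤ lcm a b h x := by
    intro x hx
    by_cases hxe : x = e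
    · subst hxe; simpa using hge x hx
    · simp [hxe]
  have key := aux_le a b h (Function.update (lcm a b h) e (h e)) ?_ ?_ e he
  · simpa using key
  · rw [concaveOn_iff_forall_pos]
    refine ⟨convex_Icc a b, ?_⟩
    intro x hx y hy c d hc hd hcd
    simp only [smul_eq_mul]
    by_cases hxe : c * x + d * y = e
    · obtain ⟨h1, h2⟩ := hext x hx y hy c d hc hd hcd hxe
      rw [hxe, h1, h2, ← add_mul, hcd, one_mul]
    · rw [Function.update_of_ne hxe]
      refine le_trans ?_ (hL.2 hx hy hc.le hd.le hcd)
      simp only [smul_eq_mul]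
      gcongr
      · exact hzL x hx
      · exact hzL y hy
  · intro x hx
    by_cases hxe : x = e
    · subst hxe; simp
    · simpa [hxe] using hge x hx

lemma aux_left (a b : ℝ) (hab : a < b) (h : ℝ → ℝ) (hcont : ContinuousOn h (Icc a b)) :
    lcm a b h a ≤ h a := by
  refine aux_end a b h hcont a ⟨le_rfl, hab.le⟩ ?_
  intro x hx y hy c d hc hd hcd he
  have h1 := mul_nonneg hc.le (sub_nonneg.2 hx.1)
  have h2 := mul_nonneg hd.le (sub_nonneg.2 hy.1)
  have h3 : c * (x - a) + d * (y - a) = 0 := by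
    have : d = 1 - c := by linarith
    subst this; linarith
  have h4 : c * (x - a) = 0 := by linarith
  have h5 : d * (y - a) = 0 := by linarith
  rw [mul_eq_zero] at h4 h5
  constructor
  · rcases h4 with h4 | h4 <;> linarith
  · rcases h5 with h5 | h5 <;> linarith

lemma aux_right (a b : ℝ) (hab : a < b) (h : ℝ → ℝ) (hcont : ContinuousOn h (Icc a b)) :
    lcm a b h b ≤ h b := by
  refine aux_end a b h hcont b ⟨hab.le, le_rfl⟩ ?_
  intro x hx y hy c d hc hd hcd he
  have h1 := mul_nonneg hc.le (sub_nonneg.2 hx.2)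
  have h2 := mul_nonneg hd.le (sub_nonneg.2 hy.2)
  have h3 : c * (b - x) + d * (b - y) = 0 := by
    have : d = 1 - c := by linarith
    subst this; linarith
  have h4 : c * (b - x) = 0 := by linarith
  have h5 : d * (b - y) = 0 := by linarith
  rw [mul_eq_zero] at h4 h5
  constructor
  · rcases h4 with h4 | h4 <;> linarith
  · rcases h5 with h5 | h5 <;> linarith

/-- three-point form of concavity -/
lemma aux_three {a b : ℝ} {f : ℝ → ℝ} (hf : ConcaveOn ℝ (Icc a b) f) {x y z : ℝ}
    (hx : x ∈ Icc a b) (hz : z ∈ Icc a b) (hxy : x < y) (hyz : y < z) :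
    (z - y) * f x + (y - x) * f z ≤ (z - x) * f y := by
  have hzx : 0 < z - x := by linarith
  have := hf.2 hx hz
    (div_nonneg (by linarith) hzx.le : 0 ≤ (z - y) / (z - x))
    (div_nonneg (by linarith) hzx.le : 0 ≤ (y - x) / (z - x)) (by field_simp; ring)
  simp only [smul_eq_mul] at this
  have e : (z - y) / (z - x) * x + (y - x) / (z - x) * z = y := by field_simp; ring
  rw [e] at this
  have h2 := mul_le_mul_of_nonneg_left this hzx.le
  refine le_trans (le_of_eq ?_) h2
  field_simp

lemma aux_contra (a b : ℝ) (h : ℝ → ℝ) (hcont : ContinuousOn h (Icc a b))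
    (p q t0 k m η : ℝ) (hp : a ≤ p) (hq : q ≤ b) (hpt : p < t0) (htq : t0 < q) (hη : 0 < η)
    (hk : k = lcm a b h t0) (hgt : h t0 < lcm a b h t0)
    (hmax : ∀ x ∈ Icc p q, lcm a b h x ≤ k + m * (x - t0) - η * (x - t0) ^ 2) : False := by
  have hL := aux_concave a b h hcont
  have hge := aux_ge a b h hcont
  have ht0 : t0 ∈ Icc a b := ⟨by linarith, by linarith⟩
  obtain ⟨g, hg, hg2⟩ : ∃ g, 0 < g ∧ g < k - h t0 :=
    ⟨(k - h t0) / 2, by linarith, by linarith⟩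
  have hc : ContinuousWithinAt (fun x => k + m * (x - t0) - h x) (Icc a b) t0 :=
    ContinuousWithinAt.sub (by fun_prop) (hcont t0 ht0)
  have hev := hc.eventually_const_lt (u := g) (by simpa using hg2)
  obtain ⟨r0, hr0, hball⟩ := Metric.mem_nhdsWithin_iff.1 hev
  obtain ⟨r, hr, hrr0, hrp, hrq⟩ : ∃ r, 0 < r ∧ r ≤ r0 ∧ r ≤ t0 - p ∧ r ≤ q - t0 :=
    ⟨min r0 (min (t0 - p) (q - t0)), by
      refine lt_min hr0 (lt_min ?_ ?_) <;> linarith, min_le_left _ _,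
      (min_le_right _ _).trans (min_le_left _ _), (min_le_right _ _).trans (min_le_right _ _)⟩
  have hfar0 : ∀ x ∈ Icc p q, r ≤ |x - t0| →
      lcm a b h x ≤ k + m * (x - t0) - η * r ^ 2 := by
    intro x hx hxr
    have h1 := hmax x hx
    have h2 : r ^ 2 ≤ (x - t0) ^ 2 := by
      rw [← sq_abs (x - t0)]; gcongr
    nlinarith
  have hηr : 0 < η * r ^ 2 := by positivity
  have hfar : ∀ x ∈ Icc a b, r ≤ |x - t0| →
      lcm a b h x ≤ k + m * (x - t0) - η * r ^ 2 := by
    intro x hx hxr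
    rcases lt_or_ge x p with hxp | hxp
    · have h1 := aux_three hL hx ht0 hxp hpt
      have h2 := hfar0 p ⟨le_rfl, by linarith⟩ (by rw [abs_sub_comm, abs_of_pos] <;> linarith)
      rw [← hk] at h1
      have h3 := mul_le_mul_of_nonneg_left h2 (show 0 ≤ t0 - x by linarith)
      have h4 : 0 ≤ (p - x) * (η * r ^ 2) := mul_nonneg (by linarith) hηr.le
      have h5 : (t0 - p) * lcm a b h x ≤ (t0 - p) * (k + m * (x - t0) - η * r ^ 2) := by
        linarith
      exact le_of_mul_le_mul_left h5 (by linarith)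
    rcases lt_or_ge q x with hxq | hxq
    · have h1 := aux_three hL ht0 hx htq hxq
      have h2 := hfar0 q ⟨by linarith, le_rfl⟩ (by rw [abs_of_pos] <;> linarith)
      rw [← hk] at h1
      have h3 := mul_le_mul_of_nonneg_left h2 (show 0 ≤ x - t0 by linarith)
      have h4 : 0 ≤ (x - q) * (η * r ^ 2) := mul_nonneg (by linarith) hηr.le
      have h5 : (q - t0) * lcm a b h x ≤ (q - t0) * (k + m * (x - t0) - η * r ^ 2) := by
        linarith
      exact le_of_mul_le_mul_left h5 (by linarith)
    exact hfar0 x ⟨hxp, hxq⟩ hxr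
  obtain ⟨ε, hε, hεg, hεr⟩ : ∃ ε, 0 < ε ∧ ε ≤ g ∧ ε ≤ η * r ^ 2 :=
    ⟨min g (η * r ^ 2), lt_min hg hηr, min_le_left _ _, min_le_right _ _⟩
  have hlin : ConcaveOn ℝ (Icc a b) (fun x => k + m * (x - t0) - ε) := by
    refine ⟨convex_Icc a b, ?_⟩
    intro x _ y _ c d _ _ hcd
    have : d = 1 - c := by linarith
    subst this
    simp only [smul_eq_mul]
    apply le_of_eq; ring
  have key := aux_le a b h _ (hL.inf hlin) (by
    intro x hx
    refine le_inf (hge x hx) ?_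
    rcases lt_or_ge (|x - t0|) r with hxr | hxr
    · have := hball ⟨by rw [Metric.mem_ball, Real.dist_eq]; linarith, hx⟩
      simp only [mem_ofPred_eq] at this
      linarith
    · have := hfar x hx hxr
      have := hge x hx
      linarith) t0 ht0
  have key2 := key.trans inf_le_right
  simp only [sub_self, mul_zero] at key2
  linarith

lemma aux_affine (a b : ℝ) (h : ℝ → ℝ) (hcont : ContinuousOn h (Icc a b))
    (p s q : ℝ) (hp : a < p) (hq : q < b) (hps : p < s) (hsq : s < q)
    (hgt : ∀ x ∈ Icc p q, h x < lcm a b h x) :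
    (q - p) * lcm a b h s = (q - s) * lcm a b h p + (s - p) * lcm a b h q := by
  have hL := aux_concave a b h hcont
  have h1 := aux_three hL (x := p) (y := s) (z := q) ⟨by linarith, by linarith⟩
    ⟨by linarith, by linarith⟩ hps hsq
  refine le_antisymm ?_ h1
  by_contra! hlt
  have hLc : ContinuousOn (lcm a b h) (Icc p q) := by
    have := (hL.subset Ioo_subset_Icc_self (convex_Ioo a b)).continuousOn isOpen_Ioo
    exact this.mono (fun x hx => ⟨by linarith [hx.1], by linarith [hx.2]⟩)
  set L := lcm a b h with hLdef
  have hqp : 0 < q - p := by linarith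
  obtain ⟨M, hM⟩ : ∃ M, M * (q - p) = L q - L p := ⟨(L q - L p) / (q - p), by field_simp⟩
  have hd : 0 < L s - L p - M * (s - p) := by
    have : 0 < (q - p) * (L s - L p - M * (s - p)) := by
      have : (q - p) * (L s - L p - M * (s - p))
        = (q - p) * L s - (q - p) * L p - (M * (q - p)) * (s - p) := by ring
      rw [this, hM]; linarith
    exact pos_of_mul_pos_right this hqp.le
  have hA : 0 < (s - p) * (q - s) := mul_pos (by linarith) (by linarith)
  obtain ⟨η, hη, hη2⟩ : ∃ η, 0 < η ∧ η * ((s - p) * (q - s)) < L s - L p - M * (s - p) :=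
    ⟨(L s - L p - M * (s - p)) / (2 * ((s - p) * (q - s))), by positivity, by
      rw [div_mul_eq_mul_div, div_lt_iff₀ (by positivity)]; nlinarith⟩
  obtain ⟨t0, ht0, hmax⟩ := isCompact_Icc.exists_isMaxOn (nonempty_Icc.2 (by linarith : p ≤ q))
    (f := fun x => L x - L p - M * (x - p) + η * ((x - p) * (x - q))) (by fun_prop)
  have hmax' : ∀ x ∈ Icc p q, L x - L p - M * (x - p) + η * ((x - p) * (x - q)) ≤
      L t0 - L p - M * (t0 - p) + η * ((t0 - p) * (t0 - q)) := fun x hx => hmax hx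
  have hs := hmax' s ⟨hps.le, hsq.le⟩
  have hpos : 0 < L t0 - L p - M * (t0 - p) + η * ((t0 - p) * (t0 - q)) := by
    have : η * ((s - p) * (s - q)) = - (η * ((s - p) * (q - s))) := by ring
    linarith
  have hpt : p < t0 := by
    rcases eq_or_lt_of_le ht0.1 with e | e
    · rw [← e] at hpos; simp at hpos
    · exact e
  have htq : t0 < q := by
    rcases eq_or_lt_of_le ht0.2 with e | e
    · rw [e] at hpos; simp [hM] at hpos
    · exact e
  refine aux_contra a b h hcont p q t0 (L t0) (M - η * (2 * t0 - p - q)) η hp.le hq.le hpt htq hη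
    rfl (hgt t0 ht0) ?_
  intro x hx
  have := hmax' x hx
  rw [← hLdef]
  nlinarith

lemma aux_open (a b : ℝ) (hab : a < b) (h : ℝ → ℝ)
    (hcont : ContinuousOn h (Icc a b)) :
    IsOpen (Subtype.val ⁻¹' {t : ℝ | lcm a b h t > h t} : Set (Icc a b)) := by
  have hL := aux_concave a b h hcont
  have hLc := (hL.subset Ioo_subset_Icc_self (convex_Ioo a b)).continuousOn isOpen_Ioo
  rw [isOpen_iff_mem_nhds]
  rintro ⟨t, ht⟩ htm
  have htm' : h t < lcm a b h t := htm
  have hta : a < t := by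
    rcases eq_or_lt_of_le ht.1 with e | e
    · subst e; exact absurd (aux_left a b hab h hcont) (not_le.2 htm')
    · exact e
  have htb : t < b := by
    rcases eq_or_lt_of_le ht.2 with e | e
    · subst e; exact absurd (aux_right a t hab h hcont) (not_le.2 htm')
    · exact e
  have hn : Icc a b ∈ nhds t := Icc_mem_nhds hta htb
  have c1 : ContinuousAt h t := hcont.continuousAt hn
  have c2 : ContinuousAt (lcm a b h) t := hLc.continuousAt (Ioo_mem_nhds hta htb)
  have := c1.eventually_lt c2 htm'
  exact continuous_subtype_val.continuousAt.preimage_mem_nhds this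

theorem lcm_gt_set_open_and_affine_on_components (a b : ℝ) (hab : a < b) (h : ℝ → ℝ)
    (hcont : ContinuousOn h (Icc a b)) :
    (IsOpen (Subtype.val ⁻¹' {t : ℝ | lcm a b h t > h t} : Set (Icc a b))) ∧
    (∀ t ∈ {t : ℝ | lcm a b h t > h t} ∩ Icc a b,
      ∃ m c : ℝ, ∀ u ∈ connectedComponentIn ({t : ℝ | lcm a b h t > h t} ∩ Icc a b) t,
        lcm a b h u = m * u + c) := by
  refine ⟨aux_open a b hab h hcont, ?_⟩
  intro t _
  have hsub := connectedComponentIn_subset ({t : ℝ | lcm a b h t > h t} ∩ Icc a b) t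
  have hord : (connectedComponentIn ({t : ℝ | lcm a b h t > h t} ∩ Icc a b) t).OrdConnected :=
    isPreconnected_connectedComponentIn.ordConnected
  generalize connectedComponentIn ({t : ℝ | lcm a b h t > h t} ∩ Icc a b) t = C at hsub hord
  have haff : ∀ p ∈ C, ∀ q ∈ C, ∀ s, p < s → s < q →
      (q - p) * lcm a b h s = (q - s) * lcm a b h p + (s - p) * lcm a b h q := by
    intro p hp q hq s hps hsq
    refine aux_affine a b h hcont p s q ?_ ?_ hps hsq
      (fun x hx => (hsub (hord.out hp hq hx)).1)
    · rcases eq_or_lt_of_le (hsub hp).2.1 with e | e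
      · have h1 : h p < lcm a b h p := (hsub hp).1
        rw [← e] at h1
        exact absurd (aux_left a b hab h hcont) (not_le.2 h1)
      · exact e
    · rcases eq_or_lt_of_le (hsub hq).2.2 with e | e
      · have h1 : h q < lcm a b h q := (hsub hq).1
        rw [e] at h1
        exact absurd (aux_right a b hab h hcont) (not_le.2 h1)
      · exact e
  by_cases hC : ∃ p ∈ C, ∃ q ∈ C, p < q
  · obtain ⟨p, hp, q, hq, hpq⟩ := hC
    obtain ⟨M, hM⟩ : ∃ M, M * (q - p) = lcm a b h q - lcm a b h p :=
      ⟨(lcm a b h q - lcm a b h p) / (q - p), by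
        have : q - p ≠ 0 := by linarith
        field_simp⟩
    refine ⟨M, lcm a b h p - M * p, fun u hu => ?_⟩
    have hq' : lcm a b h q = lcm a b h p + M * (q - p) := by linarith
    suffices hs : (q - p) * lcm a b h u = (q - p) * (M * u + (lcm a b h p - M * p)) from
      mul_left_cancel₀ (by linarith) hs
    rcases lt_trichotomy u p with h1 | h1 | h1
    · have := haff u hu q hq p h1 hpq
      rw [hq'] at this
      linarith
    · subst h1; ring
    rcases lt_trichotomy u q with h2 | h2 | h2
    · have := haff p hp q hq u h1 h2
      rw [hq'] at this
      linarith
    · subst h2; linear_combination (u - p) * hq'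
    · have := haff p hp u hu q hpq h2
      rw [hq'] at this
      linarith
  · push Not at hC
    by_cases hne : C.Nonempty
    · obtain ⟨v, hv⟩ := hne
      refine ⟨0, lcm a b h v, fun u hu => ?_⟩
      rw [le_antisymm (hC v hv u hu) (hC u hu v hv)]; ring
    · exact ⟨0, 0, fun u hu => absurd ⟨u, hu⟩ hne⟩
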